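/- arXiv:2106.03305 — 7 statements merged into one kernel-verified Lean document; each statement's English description precedes it below -/
import Mathlib

section
/- Let a, b, p be vertices with p ≠ a and p ≠ b. Suppose A is a minimum (a,p)-cut side and B is a minimum (b,p)-cut side, and suppose b ∈ A. Then A ∪ B is also a minimum (a,p)-cut side. -/
open Finset

variable {V : Type*}

/-- The cut value of a set `S`: total weight of pairs crossing `(S, Sᶜ)`. -/
def cutValue [Fintype V] [DecidableEq V] (w : V → V → ℝ) (S : Finset V) : ℝ :=
  ∑ x ∈ S, ∑ y ∈ Sᶜ, w x y

/-- `S` is an `(s,t)`-cut side if `s ∈ S` and `t ∉ S`. -/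
def IsCutSide [Fintype V] [DecidableEq V] (s t : V) (S : Finset V) : Prop :=
  s ∈ S ∧ t ∉ S

/-- `S` is a minimum `(s,t)`-cut side. -/
def IsMinCutSide [Fintype V] [DecidableEq V] (w : V → V → ℝ) (s t : V) (S : Finset V) : Prop :=
  IsCutSide s t S ∧ ∀ S' : Finset V, IsCutSide s t S' → cutValue w S ≤ cutValue w S'

/-- `S` is a latest minimum `(s,t)`-cut side: a minimum cut side of minimum cardinality
among all minimum cut sides. -/
def IsLatestMinCutSide [Fintype V] [DecidableEq V] (w : V → V → ℝ) (s t : V) (S : Finset V) : Prop :=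
  IsMinCutSide w s t S ∧ ∀ S' : Finset V, IsMinCutSide w s t S' → S.card ≤ S'.card

theorem cutValue_eq_sum_ite [Fintype V] [DecidableEq V] (w : V → V → ℝ) (S : Finset V) :
    cutValue w S = ∑ x, ∑ y, if x ∈ S ∧ y ∉ S then w x y else 0 := by
  simp only [cutValue, ite_and, ← Finset.mem_compl, Finset.sum_ite_irrel, Finset.sum_ite_mem,
    Finset.univ_inter, Finset.sum_const_zero]

/-- The cut function of a nonnegative weight is submodular. -/
theorem cutValue_union_add_cutValue_inter_le [Fintype V] [DecidableEq V] {w : V → V → ℝ}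
    (hw : ∀ x y, 0 ≤ w x y) (A B : Finset V) :
    cutValue w (A ∪ B) + cutValue w (A ∩ B) ≤ cutValue w A + cutValue w B := by
  simp only [cutValue_eq_sum_ite, ← Finset.sum_add_distrib]
  refine Finset.sum_le_sum fun x _ => Finset.sum_le_sum fun y _ => ?_
  have := hw x y
  by_cases hxA : x ∈ A <;> by_cases hxB : x ∈ B <;> by_cases hyA : y ∈ A <;>
    by_cases hyB : y ∈ B <;> simp [*]

theorem min_cut_union [Fintype V] [DecidableEq V] [Nonempty V] (w : V → V → ℝ)
    (hsymm : ∀ x y, w x y = w y x) (hnonneg : ∀ x y, 0 ≤ w x y)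
    (hzero : ∀ x, w x x = 0)
    (a b p : V) (hpa : p ≠ a) (hpb : p ≠ b)
    (A B : Finset V)
    (hA : IsMinCutSide w a p A) (hB : IsMinCutSide w b p B) (hbA : b ∈ A) :
    IsMinCutSide w a p (A ∪ B) := by
  obtain ⟨⟨haA, hpA⟩, hminA⟩ := hA
  obtain ⟨⟨hbB, hpB⟩, hminB⟩ := hB
  refine ⟨⟨mem_union_left B haA, by simp [hpA, hpB]⟩, fun S hS => ?_⟩
  have hinter := hminB (A ∩ B) ⟨mem_inter.2 ⟨hbA, hbB⟩, by simp [hpA]⟩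
  have hsub := cutValue_union_add_cutValue_inter_le hnonneg A B
  linarith [hminA S hS]
end

section
/- Let a, b, p be vertices with p ≠ a and p ≠ b. Suppose A is a minimum (a,p)-cut side and B is a minimum (b,p)-cut side, and suppose a ∉ B and b ∉ A. Then A \ B is a minimum (a,p)-cut side. -/
open Finset

variable {V : Type*}

/-- Twice the cut value, as a sum over all ordered pairs separated by `S`. -/
theorem two_mul_cutValue [Fintype V] [DecidableEq V] (w : V → V → ℝ)
    (hsymm : ∀ x y, w x y = w y x) (S : Finset V) :
    2 * cutValue w S = ∑ x, ∑ y, if (x ∈ S ↔ y ∈ S) then 0 else w x y := by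
  have h₁ : cutValue w S = ∑ x, ∑ y, if x ∈ S ∧ y ∉ S then w x y else 0 := by
    rw [cutValue, ← Finset.sum_product', ← Finset.sum_product', ← Finset.sum_filter]
    congr 1
    ext
    simp
  have h₂ : cutValue w S = ∑ x, ∑ y, if y ∈ S ∧ x ∉ S then w x y else 0 := by
    rw [h₁, Finset.sum_comm]
    simp only [hsymm]
  rw [two_mul]
  nth_rewrite 1 [h₁]
  rw [h₂]
  simp only [← Finset.sum_add_distrib]
  refine Finset.sum_congr rfl fun x _ => Finset.sum_congr rfl fun y _ => ?_
  by_cases hx : x ∈ S <;> by_cases hy : y ∈ S <;> simp [hx, hy]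

/-- Posimodularity of the cut function of an undirected graph. -/
theorem cutValue_sdiff_add_cutValue_sdiff_le [Fintype V] [DecidableEq V] (w : V → V → ℝ)
    (hsymm : ∀ x y, w x y = w y x) (hnonneg : ∀ x y, 0 ≤ w x y) (A B : Finset V) :
    cutValue w (A \ B) + cutValue w (B \ A) ≤ cutValue w A + cutValue w B := by
  suffices h : 2 * cutValue w (A \ B) + 2 * cutValue w (B \ A) ≤
      2 * cutValue w A + 2 * cutValue w B by linarith
  simp only [two_mul_cutValue w hsymm, ← Finset.sum_add_distrib]
  refine Finset.sum_le_sum fun x _ => Finset.sum_le_sum fun y _ => ?_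
  have := hnonneg x y
  by_cases hxA : x ∈ A <;> by_cases hxB : x ∈ B <;> by_cases hyA : y ∈ A <;>
    by_cases hyB : y ∈ B <;> simp [hxA, hxB, hyA, hyB, this]

theorem min_cut_sdiff [Fintype V] [DecidableEq V] [Nonempty V] (w : V → V → ℝ)
    (hsymm : ∀ x y, w x y = w y x) (hnonneg : ∀ x y, 0 ≤ w x y)
    (hzero : ∀ x, w x x = 0)
    (a b p : V) (hpa : p ≠ a) (hpb : p ≠ b)
    (A B : Finset V)
    (hA : IsMinCutSide w a p A) (hB : IsMinCutSide w b p B)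
    (haB : a ∉ B) (hbA : b ∉ A) :
    IsMinCutSide w a p (A \ B) := by
  refine ⟨⟨mem_sdiff.2 ⟨hA.1.1, haB⟩, fun h => hA.1.2 (mem_sdiff.1 h).1⟩, fun S' hS' => ?_⟩
  have hBA : cutValue w B ≤ cutValue w (B \ A) :=
    hB.2 _ ⟨mem_sdiff.2 ⟨hB.1.1, hbA⟩, fun h => hB.1.2 (mem_sdiff.1 h).1⟩
  linarith [hA.2 S' hS', cutValue_sdiff_add_cutValue_sdiff_le w hsymm hnonneg A B]
end

section
/- Let s, t be distinct vertices. If A and B are both minimum (s,t)-cut sides, then A ∩ B and A ∪ B are also minimum (s,t)-cut sides. -/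
open Finset

variable {V : Type*}

/-- The cut function of a nonnegatively weighted graph is submodular. -/
theorem cutValue_inter_add_cutValue_union_le [Fintype V] [DecidableEq V] {w : V → V → ℝ}
    (hw : ∀ x y, 0 ≤ w x y) (A B : Finset V) :
    cutValue w (A ∩ B) + cutValue w (A ∪ B) ≤ cutValue w A + cutValue w B := by
  simp only [cutValue_eq_sum_ite, ← sum_add_distrib]
  refine sum_le_sum fun x _ => sum_le_sum fun y _ => ?_
  have := hw x y
  by_cases x ∈ A <;> by_cases x ∈ B <;> by_cases y ∈ A <;> by_cases y ∈ B <;> simp [*]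

theorem min_cut_inter_union [Fintype V] [DecidableEq V] [Nonempty V] (w : V → V → ℝ)
    (hsymm : ∀ x y, w x y = w y x) (hnonneg : ∀ x y, 0 ≤ w x y)
    (hzero : ∀ x, w x x = 0)
    (s t : V) (hst : s ≠ t)
    (A B : Finset V)
    (hA : IsMinCutSide w s t A) (hB : IsMinCutSide w s t B) :
    IsMinCutSide w s t (A ∩ B) ∧ IsMinCutSide w s t (A ∪ B) := by
  have hi : IsCutSide s t (A ∩ B) :=
    ⟨mem_inter.2 ⟨hA.1.1, hB.1.1⟩, fun h => hA.1.2 (mem_inter.1 h).1⟩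
  have hu : IsCutSide s t (A ∪ B) :=
    ⟨mem_union_left B hA.1.1, fun h => (mem_union.1 h).elim hA.1.2 hB.1.2⟩
  have hsub := cutValue_inter_add_cutValue_union_le hnonneg A B
  have hAu := hA.2 _ hu
  have hBi := hB.2 _ hi
  exact ⟨⟨hi, fun S hS => by linarith [hB.2 S hS]⟩, ⟨hu, fun S hS => by linarith [hA.2 S hS]⟩⟩
end

section
/- Let G be a finite simple graph on vertex set V, let φ > 0 be a real number, and let C ⊆ V be such that for every S ⊆ C one has e_G(S, C \ S) ≥ φ · min(vol_G(S), vol_G(C \ S)) (i.e., the induced subgraph on C with degrees preserved as in G is a φ-expander). Let d be a positive integer and let X = {v ∈ C : deg_G(v) ≥ d}. If L ⊆ V satisfies out_G(L) < 2d, then |L ∩ X| ≤ 2/φ or |X \ L| ≤ 2/φ. -/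
open Finset

variable {V : Type*} [Fintype V] [DecidableEq V]

/-- The volume of a vertex set: sum of degrees. -/
def volG (G : SimpleGraph V) [DecidableRel G.Adj] (S : Finset V) : ℕ :=
  ∑ v ∈ S, G.degree v

/-- The number of edges with exactly one endpoint in `S`. -/
def outG (G : SimpleGraph V) [DecidableRel G.Adj] (S : Finset V) : ℕ :=
  ∑ v ∈ S, ((G.neighborFinset v).filter (fun x => x ∉ S)).card

/-- The number of edges with one endpoint in `S` and the other in `T`
(for disjoint `S` and `T`). -/
def eG (G : SimpleGraph V) [DecidableRel G.Adj] (S T : Finset V) : ℕ :=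
  ∑ v ∈ S, ((G.neighborFinset v).filter (fun x => x ∈ T)).card

theorem eG_inter_sdiff_le_outG (G : SimpleGraph V) [DecidableRel G.Adj] (L C : Finset V) :
    eG G (L ∩ C) (C \ (L ∩ C)) ≤ outG G L := by
  unfold eG outG
  refine (Finset.sum_le_sum fun v _ => Finset.card_le_card ?_).trans
    (Finset.sum_le_sum_of_subset Finset.inter_subset_left)
  intro x hx
  simp only [Finset.mem_filter, Finset.mem_sdiff, Finset.mem_inter] at hx ⊢
  tauto

theorem card_mul_le_volG (G : SimpleGraph V) [DecidableRel G.Adj] {S T : Finset V} {d : ℕ}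
    (hST : S ⊆ T) (hd : ∀ v ∈ S, d ≤ G.degree v) : S.card * d ≤ volG G T := by
  unfold volG
  rw [← smul_eq_mul]
  exact (Finset.card_nsmul_le_sum S _ d hd).trans (Finset.sum_le_sum_of_subset hST)

theorem expander_cut_imbalance (G : SimpleGraph V) [DecidableRel G.Adj]
    (φ : ℝ) (hφ : 0 < φ) (C : Finset V)
    (hexp : ∀ S ⊆ C, (eG G S (C \ S) : ℝ) ≥
      φ * min (volG G S : ℝ) (volG G (C \ S) : ℝ))
    (d : ℕ) (hd : 0 < d)
    (X : Finset V) (hX : X = C.filter (fun v => d ≤ G.degree v))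
    (L : Finset V) (hL : outG G L < 2 * d) :
    ((L ∩ X).card : ℝ) ≤ 2 / φ ∨ ((X \ L).card : ℝ) ≤ 2 / φ := by
  by_contra! h
  obtain ⟨h₁, h₂⟩ := h
  rw [div_lt_iff₀ hφ] at h₁ h₂
  have hd' : (0 : ℝ) < d := by exact_mod_cast hd
  have v₁ : ((L ∩ X).card : ℝ) * d ≤ volG G (L ∩ C) := by
    exact_mod_cast card_mul_le_volG G (S := L ∩ X) (by subst hX; grind) (by subst hX; grind)
  have v₂ : ((X \ L).card : ℝ) * d ≤ volG G (C \ (L ∩ C)) := by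
    exact_mod_cast card_mul_le_volG G (S := X \ L) (by subst hX; grind) (by subst hX; grind)
  have hcut : (eG G (L ∩ C) (C \ (L ∩ C)) : ℝ) < 2 * d := by
    exact_mod_cast (eG_inter_sdiff_le_outG G L C).trans_lt hL
  have hmin := (hexp (L ∩ C) Finset.inter_subset_right).trans_lt hcut
  rw [mul_min_of_nonneg _ _ hφ.le, min_lt_iff] at hmin
  rcases hmin with hmin | hmin
  · nlinarith [mul_le_mul_of_nonneg_left v₁ hφ.le, mul_lt_mul_of_pos_right h₁ hd']
  · nlinarith [mul_le_mul_of_nonneg_left v₂ hφ.le, mul_lt_mul_of_pos_right h₂ hd']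
end

section
/- Let G be a finite simple graph on n vertices, and let s, d be positive integers with 4s ≤ d. Let 𝒞 be a family of pairwise disjoint subsets of V such that every C ∈ 𝒞 satisfies s ≤ |C| < 2s and out_G(C) ≤ vol_G(C)/10. Then the number of vertices v ∈ ⋃𝒞 with deg_G(v) ≥ d is at most 2sn/d. -/
open Finset

variable {V : Type*} [Fintype V] [DecidableEq V]

/-- The neighbours of `v` split into at most `#S` neighbours inside `S` and those outside `S`. -/
lemma degree_le_card_add_card_neighborFinset_filter_notMem (G : SimpleGraph V)
    [DecidableRel G.Adj] (S : Finset V) (v : V) :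
    G.degree v ≤ S.card + ((G.neighborFinset v).filter (fun x => x ∉ S)).card := by
  rw [← G.card_neighborFinset_eq_degree,
    ← Finset.card_filter_add_card_filter_not (s := G.neighborFinset v) (fun x => x ∈ S)]
  gcongr
  intro x hx
  exact (Finset.mem_filter.mp hx).2

lemma volG_le_card_mul_card_add_outG (G : SimpleGraph V) [DecidableRel G.Adj] (S : Finset V) :
    volG G S ≤ S.card * S.card + outG G S := by
  have h := Finset.sum_le_sum fun v (_ : v ∈ S) =>
    degree_le_card_add_card_neighborFinset_filter_notMem G S v
  rwa [Finset.sum_add_distrib, Finset.sum_const, smul_eq_mul] at h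

/-- In a set of size at most `d / 2`, each vertex of degree at least `d` sends at least `d / 2`
edges out of the set. -/
lemma card_filter_le_degree_mul_le_two_mul_outG (G : SimpleGraph V) [DecidableRel G.Adj]
    (S : Finset V) {d : ℕ} (hd : 2 * S.card ≤ d) :
    (S.filter (fun v => d ≤ G.degree v)).card * d ≤ 2 * outG G S := by
  rw [outG, Finset.mul_sum, ← smul_eq_mul, ← Finset.sum_const]
  refine (Finset.sum_le_sum fun v hv => ?_).trans
    (Finset.sum_le_sum_of_subset (Finset.filter_subset _ S))
  have hdeg := (Finset.mem_filter.mp hv).2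
  have := degree_le_card_add_card_neighborFinset_filter_notMem G S v
  omega

lemma card_filter_le_degree_mul_le_of_outG_le (G : SimpleGraph V) [DecidableRel G.Adj]
    (S : Finset V) {s d : ℕ} (hsd : 4 * s ≤ d) (hS : S.card < 2 * s)
    (hout : 10 * outG G S ≤ volG G S) :
    (S.filter (fun v => d ≤ G.degree v)).card * d ≤ 2 * s * S.card := by
  have hvol := volG_le_card_mul_card_add_outG G S
  have hhigh := card_filter_le_degree_mul_le_two_mul_outG G S (d := d) (by omega)
  have hsq := Nat.mul_le_mul_right S.card hS.le
  omega

theorem high_degree_in_small_clusters (G : SimpleGraph V) [DecidableRel G.Adj]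
    (s d : ℕ) (hs : 0 < s) (hd : 0 < d) (hsd : 4 * s ≤ d)
    (𝒞 : Finset (Finset V))
    (hdisj : (𝒞 : Set (Finset V)).Pairwise fun C C' => Disjoint C C')
    (hsize : ∀ C ∈ 𝒞, s ≤ C.card ∧ C.card < 2 * s)
    (hbound : ∀ C ∈ 𝒞, (outG G C : ℝ) ≤ (volG G C : ℝ) / 10) :
    (((𝒞.biUnion id).filter (fun v => d ≤ G.degree v)).card : ℝ) ≤
      2 * s * (Fintype.card V) / d := by
  rw [le_div_iff₀ (by exact_mod_cast hd)]
  norm_cast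
  rw [Finset.filter_biUnion]
  calc (𝒞.biUnion fun C => (id C).filter (fun v => d ≤ G.degree v)).card * d
      ≤ (∑ C ∈ 𝒞, (C.filter (fun v => d ≤ G.degree v)).card) * d :=
        Nat.mul_le_mul_right d Finset.card_biUnion_le
    _ = ∑ C ∈ 𝒞, (C.filter (fun v => d ≤ G.degree v)).card * d := Finset.sum_mul ..
    _ ≤ ∑ C ∈ 𝒞, 2 * s * C.card := by
        refine Finset.sum_le_sum fun C hC =>
          card_filter_le_degree_mul_le_of_outG_le G C hsd (hsize C hC).2 ?_
        have h := hbound C hC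
        rw [le_div_iff₀ (by norm_num), mul_comm] at h
        exact_mod_cast h
    _ = 2 * s * (𝒞.biUnion id).card := by
        rw [← Finset.mul_sum, Finset.card_biUnion (t := id) hdisj]
        rfl
    _ ≤ 2 * s * Fintype.card V := Nat.mul_le_mul_left _ (Finset.card_le_univ _)
end

section
/- Let G be a finite simple graph on n vertices and let s be a positive integer. Let 𝒞 be a family of pairwise disjoint subsets of V such that every C ∈ 𝒞 satisfies s ≤ |C| < 2s and out_G(C) ≤ vol_G(C)/10. Then ∑_{C ∈ 𝒞} out_G(C) < s·n. -/
open Finset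

variable {V : Type*} [Fintype V] [DecidableEq V]

/-- The volume of `S` exceeds its boundary by at most `S.card ^ 2`. -/
theorem volG_le_outG_add_card_mul_card (G : SimpleGraph V) [DecidableRel G.Adj] (S : Finset V) :
    volG G S ≤ outG G S + S.card * S.card := by
  unfold volG outG
  rw [← smul_eq_mul, ← Finset.sum_const, ← Finset.sum_add_distrib]
  refine Finset.sum_le_sum fun v _ => ?_
  rw [← G.card_neighborFinset_eq_degree,
    ← Finset.card_filter_add_card_filter_not (s := G.neighborFinset v) (fun x => x ∈ S), add_comm]
  exact Nat.add_le_add_left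
    (Finset.card_le_card fun x hx => (Finset.mem_filter.mp hx).2) _

theorem total_boundary_small (G : SimpleGraph V) [Nonempty V] [DecidableRel G.Adj]
    (s : ℕ) (hs : 0 < s)
    (𝒞 : Finset (Finset V))
    (hdisj : (𝒞 : Set (Finset V)).Pairwise fun C C' => Disjoint C C')
    (hsize : ∀ C ∈ 𝒞, s ≤ C.card ∧ C.card < 2 * s)
    (hbound : ∀ C ∈ 𝒞, (outG G C : ℝ) ≤ (volG G C : ℝ) / 10) :
    ∑ C ∈ 𝒞, outG G C < s * Fintype.card V := by
  have nine_mul_outG_le : ∀ C ∈ 𝒞, 9 * outG G C ≤ 2 * s * C.card := by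
    intro C hC
    have hvol := volG_le_outG_add_card_mul_card G C
    have hout : 10 * outG G C ≤ volG G C := by
      have h := hbound C hC
      have : (10 * outG G C : ℝ) ≤ volG G C := by linarith
      exact_mod_cast this
    have hcard := Nat.mul_le_mul_right C.card (hsize C hC).2.le
    omega
  have hcover : ∑ C ∈ 𝒞, C.card ≤ Fintype.card V := by
    rw [← Finset.card_biUnion hdisj]
    exact Finset.card_le_univ _
  have hsum : 9 * ∑ C ∈ 𝒞, outG G C ≤ 2 * s * ∑ C ∈ 𝒞, C.card := by
    rw [Finset.mul_sum, Finset.mul_sum]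
    exact Finset.sum_le_sum nine_mul_outG_le
  have hpos : 0 < s * Fintype.card V := Nat.mul_pos hs Fintype.card_pos
  nlinarith [Nat.mul_le_mul_left (2 * s) hcover]
end

section
/- Let G be a finite simple graph on vertex set V, let s and d be positive integers, and let C ⊆ V be a set with |C| < 2s satisfying out_G(C) ≤ vol_G(C)/10. If there exists a vertex u ∈ C with deg_G(u) ≥ d, then out_G(C) < s²/2 and consequently 2d < s² + 4s (so s is at least on the order of √(2d)). -/
open Finset

variable {V : Type*} [Fintype V] [DecidableEq V]

/-- The degree of a vertex is at most its number of neighbors outside `S` plus `S.card`. -/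
theorem degree_le_card_filter_notMem_add_card (G : SimpleGraph V) [DecidableRel G.Adj]
    (S : Finset V) (v : V) :
    G.degree v ≤ ((G.neighborFinset v).filter (fun x => x ∉ S)).card + S.card := by
  have hsplit := card_filter_add_card_filter_not (s := G.neighborFinset v) (fun x => x ∈ S)
  have hin : ((G.neighborFinset v).filter (fun x => x ∈ S)).card ≤ S.card :=
    card_le_card fun x hx => (mem_filter.mp hx).2
  rw [G.card_neighborFinset_eq_degree] at hsplit
  omega

theorem degree_le_outG_add_card (G : SimpleGraph V) [DecidableRel G.Adj]
    {S : Finset V} {v : V} (hv : v ∈ S) : G.degree v ≤ outG G S + S.card := by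
  refine (degree_le_card_filter_notMem_add_card G S v).trans (Nat.add_le_add_right ?_ _)
  exact single_le_sum (f := fun v => ((G.neighborFinset v).filter (fun x => x ∉ S)).card)
    (fun _ _ => Nat.zero_le _) hv

theorem cluster_size_lower_bound (G : SimpleGraph V) [DecidableRel G.Adj]
    (s d : ℕ) (hs : 0 < s) (hd : 0 < d)
    (C : Finset V) (hC : C.card < 2 * s)
    (hbound : (outG G C : ℝ) ≤ (volG G C : ℝ) / 10)
    (u : V) (hu : u ∈ C) (hdeg : d ≤ G.degree u) :
    (outG G C : ℝ) < (s : ℝ) ^ 2 / 2 ∧ (2 * d : ℝ) < (s : ℝ) ^ 2 + 4 * s := by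
  have hvol : (volG G C : ℝ) ≤ outG G C + (C.card : ℝ) * C.card := by
    exact_mod_cast volG_le_outG_add_card_mul_card G C
  have hd_le : (d : ℝ) ≤ outG G C + C.card := by
    exact_mod_cast hdeg.trans (degree_le_outG_add_card G hu)
  have hcard : (C.card : ℝ) < 2 * s := by exact_mod_cast hC
  have hsq : (C.card : ℝ) * C.card < (2 * s) * (2 * s) :=
    mul_self_lt_mul_self (Nat.cast_nonneg _) hcard
  have hout : (outG G C : ℝ) < (s : ℝ) ^ 2 / 2 := by nlinarith [sq_nonneg (s : ℝ)]
  exact ⟨hout, by linarith⟩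
end
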